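/- arXiv:2302.11808 — 2 statements merged into one kernel-verified Lean document; each statement's English description precedes it below -/
import Mathlib

section
/- Let ∘ ∈ {∧, ∨} and k be a natural number. (A) If φ ∈ Σ_{k+1}^+, ψ ∈ Σ_{k+1}^+, and k+1 = max{deg(φ), deg(ψ)}, then there exists σ ∈ Σ_{k+1} such that φ ∘ ψ ⊳* σ. (B) If φ ∈ Π_{k+1}^+, ψ ∈ Π_{k+1}^+, and k+1 = max{deg(φ), deg(ψ)}, then there exists π ∈ Π_{k+1} such that φ ∘ ψ ⊳* π. -/
namespace PrenexPaper

/-- A first-order language: function symbols and relation symbols with arities. -/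
structure Lang where
  Func : Type
  farity : Func → ℕ
  Rel : Type
  rarity : Rel → ℕ

/-- First-order terms over a language `L` with variables from `V`. -/
inductive Term (L : Lang) (V : Type) : Type
  | var : V → Term L V
  | func : (f : L.Func) → (Fin (L.farity f) → Term L V) → Term L V

/-- First-order formulas built from atomic formulas (including ⊥) by ∧, ∨, →, ∀x, ∃x. -/
inductive Fml (L : Lang) (V : Type) : Type
  | falsum : Fml L V
  | rel : (r : L.Rel) → (Fin (L.rarity r) → Term L V) → Fml L V
  | and : Fml L V → Fml L V → Fml L V
  | or : Fml L V → Fml L V → Fml L V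
  | imp : Fml L V → Fml L V → Fml L V
  | all : V → Fml L V → Fml L V
  | ex : V → Fml L V → Fml L V

variable {L : Lang} {V : Type}

/-- Variables occurring in a term. -/
def Term.vars : Term L V → Set V
  | .var x => {x}
  | .func _ ts => ⋃ i, (ts i).vars

/-- Free variables of a formula. -/
def Fml.fv : Fml L V → Set V
  | .falsum => ∅
  | .rel _ ts => ⋃ i, (ts i).vars
  | .and φ ψ => φ.fv ∪ ψ.fv
  | .or φ ψ => φ.fv ∪ ψ.fv
  | .imp φ ψ => φ.fv ∪ ψ.fv
  | .all x φ => φ.fv \ {x}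
  | .ex x φ => φ.fv \ {x}

/-- All variables appearing in a formula (free or bound). -/
def Fml.vars : Fml L V → Set V
  | .falsum => ∅
  | .rel _ ts => ⋃ i, (ts i).vars
  | .and φ ψ => φ.vars ∪ ψ.vars
  | .or φ ψ => φ.vars ∪ ψ.vars
  | .imp φ ψ => φ.vars ∪ ψ.vars
  | .all x φ => insert x φ.vars
  | .ex x φ => insert x φ.vars

/-- Number of quantifier occurrences. -/
def Fml.numQ : Fml L V → ℕ
  | .falsum => 0
  | .rel _ _ => 0
  | .and φ ψ => φ.numQ + ψ.numQ
  | .or φ ψ => φ.numQ + ψ.numQ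
  | .imp φ ψ => φ.numQ + ψ.numQ
  | .all _ φ => φ.numQ + 1
  | .ex _ φ => φ.numQ + 1

/-- Number of occurrences of the binary connectives ∧, ∨, →. -/
def Fml.numConn : Fml L V → ℕ
  | .falsum => 0
  | .rel _ _ => 0
  | .and φ ψ => φ.numConn + ψ.numConn + 1
  | .or φ ψ => φ.numConn + ψ.numConn + 1
  | .imp φ ψ => φ.numConn + ψ.numConn + 1
  | .all _ φ => φ.numConn
  | .ex _ φ => φ.numConn

/-- Quantifier-free formulas. -/
def Fml.qf : Fml L V → Prop
  | .falsum => True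
  | .rel _ _ => True
  | .and φ ψ => φ.qf ∧ ψ.qf
  | .or φ ψ => φ.qf ∧ ψ.qf
  | .imp φ ψ => φ.qf ∧ ψ.qf
  | .all _ _ => False
  | .ex _ _ => False

/-! ### Alternation paths and the classes E, U, F, PF

An alternation path is represented as a `List Bool`, where `true` stands for `+`
and `false` stands for `−` (alternation is automatic from the construction below). -/

/-- `s^⊥`: switch + and − in an alternation path. -/
def negPath (s : List Bool) : List Bool := s.map (fun b => !b)

/-- The set `Alt(φ)` of alternation paths of a formula.  The first symbol `i(s)` of a
path `s` is `s.head?` (`none` corresponding to `×` for the empty path). -/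
def Fml.alt : Fml L V → Set (List Bool)
  | .falsum => {[]}
  | .rel _ _ => {[]}
  | .and φ ψ => φ.alt ∪ ψ.alt
  | .or φ ψ => φ.alt ∪ ψ.alt
  | .imp φ ψ => (negPath '' φ.alt) ∪ ψ.alt
  | .all _ φ => {s ∈ φ.alt | s.head? = some false} ∪
      (fun s => false :: s) '' {s ∈ φ.alt | s.head? ≠ some false}
  | .ex _ φ => {s ∈ φ.alt | s.head? = some true} ∪
      (fun s => true :: s) '' {s ∈ φ.alt | s.head? ≠ some true}

/-- The degree `deg(φ) = max { l(s) | s ∈ Alt(φ) }`. -/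
noncomputable def Fml.deg (φ : Fml L V) : ℕ := sSup (List.length '' φ.alt)

/-- The class `F_k` of formulas of degree exactly `k`. -/
def Fc (k : ℕ) : Set (Fml L V) := {φ | φ.deg = k}

/-- The cumulative class `F_k^+` of formulas of degree at most `k`. -/
def FcP (k : ℕ) : Set (Fml L V) := {φ | φ.deg ≤ k}

/-- The class `U_k`. -/
def Uc : ℕ → Set (Fml L V)
  | 0 => Fc 0
  | (k+1) => {φ | φ ∈ Fc (k+1) ∧ ∀ s ∈ φ.alt, s.length = k+1 → s.head? = some false}

/-- The class `E_k`. -/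
def Ec : ℕ → Set (Fml L V)
  | 0 => Fc 0
  | (k+1) => {φ | φ ∈ Fc (k+1) ∧ ∀ s ∈ φ.alt, s.length = k+1 → s.head? = some true}

/-- The class `PF_k = F_k \ (E_k ∪ U_k)`. -/
def PFc (k : ℕ) : Set (Fml L V) := Fc k \ (Ec k ∪ Uc k)

/-- The cumulative class `U_k^+ = U_k ∪ ⋃_{i<k} F_i`. -/
def UcP (k : ℕ) : Set (Fml L V) := Uc k ∪ ⋃ i < k, Fc i

/-- The cumulative class `E_k^+ = E_k ∪ ⋃_{i<k} F_i`. -/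
def EcP (k : ℕ) : Set (Fml L V) := Ec k ∪ ⋃ i < k, Fc i

/-! ### The prenex classes Σ_k and Π_k -/

/-- Formulas `∃x₁⋯∃xₙ φ` with `n ≥ 1` and `φ ∈ S`. -/
inductive ExBlock (S : Set (Fml L V)) : Fml L V → Prop
  | one {x : V} {φ : Fml L V} : φ ∈ S → ExBlock S (.ex x φ)
  | more {x : V} {φ : Fml L V} : ExBlock S φ → ExBlock S (.ex x φ)

/-- Formulas `∀x₁⋯∀xₙ φ` with `n ≥ 1` and `φ ∈ S`. -/
inductive AllBlock (S : Set (Fml L V)) : Fml L V → Prop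
  | one {x : V} {φ : Fml L V} : φ ∈ S → AllBlock S (.all x φ)
  | more {x : V} {φ : Fml L V} : AllBlock S φ → AllBlock S (.all x φ)

/-- The pair `(Σ_k, Π_k)`. -/
def SP : ℕ → Set (Fml L V) × Set (Fml L V)
  | 0 => ({φ | φ.qf}, {φ | φ.qf})
  | (k+1) => ({φ | ExBlock (SP k).2 φ}, {φ | AllBlock (SP k).1 φ})

/-- The class `Σ_k`. -/
def SigmaC (k : ℕ) : Set (Fml L V) := (SP k).1

/-- The class `Π_k`. -/
def PiC (k : ℕ) : Set (Fml L V) := (SP k).2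

/-- The cumulative class `Σ_k^+ = Σ_k ∪ ⋃_{i<k} (Σ_i ∪ Π_i)`. -/
def SigmaP (k : ℕ) : Set (Fml L V) := SigmaC k ∪ ⋃ i < k, (SigmaC i ∪ PiC i)

/-- The cumulative class `Π_k^+ = Π_k ∪ ⋃_{i<k} (Σ_i ∪ Π_i)`. -/
def PiP (k : ℕ) : Set (Fml L V) := PiC k ∪ ⋃ i < k, (SigmaC i ∪ PiC i)

/-- A formula is in prenex normal form if it is in `Σ_k ∪ Π_k` for some `k`. -/
def Prenex (φ : Fml L V) : Prop := ∃ k, φ ∈ SigmaC k ∪ PiC k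

/-! ### Prenex transformations -/

variable [DecidableEq V]

/-- Replace the variable `x` by `y` in a term. -/
def Term.rename (x y : V) : Term L V → Term L V
  | .var z => if z = x then .var y else .var z
  | .func f ts => .func f (fun i => (ts i).rename x y)

/-- Replace the free occurrences of the variable `x` by `y` in a formula. -/
def Fml.rename (x y : V) : Fml L V → Fml L V
  | .falsum => .falsum
  | .rel r ts => .rel r (fun i => (ts i).rename x y)
  | .and φ ψ => .and (φ.rename x y) (ψ.rename x y)
  | .or φ ψ => .or (φ.rename x y) (ψ.rename x y)
  | .imp φ ψ => .imp (φ.rename x y) (ψ.rename x y)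
  | .all z φ => if z = x then .all z φ else .all z (φ.rename x y)
  | .ex z φ => if z = x then .ex z φ else .ex z (φ.rename x y)

/-- `φ ⊳ ψ` : `ψ` is a prenex transformation of `φ` (the eight rows of the table,
rows 3–8 for both quantifiers). -/
inductive Step : Fml L V → Fml L V → Prop
  | r1 (x : V) (ξ δ : Fml L V) (h : x ∉ δ.fv) :
      Step (.imp (.ex x ξ) δ) (.all x (.imp ξ δ))
  | r2 (x : V) (ξ δ : Fml L V) (h : x ∉ δ.fv) :
      Step (.imp (.all x ξ) δ) (.ex x (.imp ξ δ))
  | r3all (x : V) (ξ δ : Fml L V) (h : x ∉ δ.fv) :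
      Step (.imp δ (.all x ξ)) (.all x (.imp δ ξ))
  | r3ex (x : V) (ξ δ : Fml L V) (h : x ∉ δ.fv) :
      Step (.imp δ (.ex x ξ)) (.ex x (.imp δ ξ))
  | r4all (x : V) (ξ δ : Fml L V) (h : x ∉ δ.fv) :
      Step (.and (.all x ξ) δ) (.all x (.and ξ δ))
  | r4ex (x : V) (ξ δ : Fml L V) (h : x ∉ δ.fv) :
      Step (.and (.ex x ξ) δ) (.ex x (.and ξ δ))
  | r5all (x : V) (ξ δ : Fml L V) (h : x ∉ δ.fv) :
      Step (.and δ (.all x ξ)) (.all x (.and δ ξ))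
  | r5ex (x : V) (ξ δ : Fml L V) (h : x ∉ δ.fv) :
      Step (.and δ (.ex x ξ)) (.ex x (.and δ ξ))
  | r6all (x : V) (ξ δ : Fml L V) (h : x ∉ δ.fv) :
      Step (.or (.all x ξ) δ) (.all x (.or ξ δ))
  | r6ex (x : V) (ξ δ : Fml L V) (h : x ∉ δ.fv) :
      Step (.or (.ex x ξ) δ) (.ex x (.or ξ δ))
  | r7all (x : V) (ξ δ : Fml L V) (h : x ∉ δ.fv) :
      Step (.or δ (.all x ξ)) (.all x (.or δ ξ))
  | r7ex (x : V) (ξ δ : Fml L V) (h : x ∉ δ.fv) :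
      Step (.or δ (.ex x ξ)) (.ex x (.or δ ξ))
  | r8all (x y : V) (ξ : Fml L V) (h : y ∉ ξ.vars) :
      Step (.all x ξ) (.all y (ξ.rename x y))
  | r8ex (x y : V) (ξ : Fml L V) (h : y ∉ ξ.vars) :
      Step (.ex x ξ) (.ex y (ξ.rename x y))

/-- `Repl R φ ψ` : `ψ` is obtained from `φ` by replacing one occurrence of a
subformula `ξ` of `φ` with a formula `δ` such that `R ξ δ`. -/
inductive Repl (R : Fml L V → Fml L V → Prop) : Fml L V → Fml L V → Prop
  | base {φ ψ : Fml L V} : R φ ψ → Repl R φ ψ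
  | andL {φ φ' ψ : Fml L V} : Repl R φ φ' → Repl R (.and φ ψ) (.and φ' ψ)
  | andR {φ ψ ψ' : Fml L V} : Repl R ψ ψ' → Repl R (.and φ ψ) (.and φ ψ')
  | orL {φ φ' ψ : Fml L V} : Repl R φ φ' → Repl R (.or φ ψ) (.or φ' ψ)
  | orR {φ ψ ψ' : Fml L V} : Repl R ψ ψ' → Repl R (.or φ ψ) (.or φ ψ')
  | impL {φ φ' ψ : Fml L V} : Repl R φ φ' → Repl R (.imp φ ψ) (.imp φ' ψ)
  | impR {φ ψ ψ' : Fml L V} : Repl R ψ ψ' → Repl R (.imp φ ψ) (.imp φ ψ')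
  | allC {x : V} {φ φ' : Fml L V} : Repl R φ φ' → Repl R (.all x φ) (.all x φ')
  | exC {x : V} {φ φ' : Fml L V} : Repl R φ φ' → Repl R (.ex x φ) (.ex x φ')

/-- `φ ⊳* ψ` : `ψ` is obtained from `φ` by finitely many prenex transformations,
each applied to one occurrence of a subformula. -/
def DTA : Fml L V → Fml L V → Prop := Relation.ReflTransGen (Repl Step)

/-- `PNF(φ)` : the set of prenex normal forms reachable from `φ`. -/
def PNF (φ : Fml L V) : Set (Fml L V) := {ψ | DTA φ ψ ∧ Prenex ψ}

/-! ### Tarskian semantics -/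

/-- A structure for the language `L` with domain `M`. -/
structure Struc (L : Lang) (M : Type) where
  funcI : (f : L.Func) → (Fin (L.farity f) → M) → M
  relI : (r : L.Rel) → (Fin (L.rarity r) → M) → Prop

/-- Evaluation of a term in a structure under a variable assignment. -/
def Term.eval {M : Type} (S : Struc L M) (v : V → M) : Term L V → M
  | .var x => v x
  | .func f ts => S.funcI f (fun i => (ts i).eval S v)

/-- Tarskian satisfaction of a formula in a structure under a variable assignment. -/
def Sat {M : Type} (S : Struc L M) (v : V → M) : Fml L V → Prop
  | .falsum => False
  | .rel r ts => S.relI r (fun i => (ts i).eval S v)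
  | .and φ ψ => Sat S v φ ∧ Sat S v ψ
  | .or φ ψ => Sat S v φ ∨ Sat S v ψ
  | .imp φ ψ => Sat S v φ → Sat S v ψ
  | .all x φ => ∀ m : M, Sat S (Function.update v x m) φ
  | .ex x φ => ∃ m : M, Sat S (Function.update v x m) φ

/-! ### Helper lemmas -/

theorem Term.vars_finite {L : Lang} {V : Type} (t : Term L V) : t.vars.Finite := by
  induction t with
  | var x => exact Set.finite_singleton x
  | func f ts ih => exact Set.finite_iUnion ih

theorem Fml.vars_finite {L : Lang} {V : Type} (φ : Fml L V) : φ.vars.Finite := by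
  induction φ with
  | falsum => exact Set.finite_empty
  | rel r ts => exact Set.finite_iUnion fun i => (ts i).vars_finite
  | and _ _ h1 h2 => exact h1.union h2
  | or _ _ h1 h2 => exact h1.union h2
  | imp _ _ h1 h2 => exact h1.union h2
  | all x _ h => exact h.insert x
  | ex x _ h => exact h.insert x

theorem Fml.fv_subset_vars {L : Lang} {V : Type} (φ : Fml L V) : φ.fv ⊆ φ.vars := by
  induction φ with
  | falsum => exact subset_rfl
  | rel r ts => exact subset_rfl
  | and _ _ h1 h2 => exact Set.union_subset_union h1 h2
  | or _ _ h1 h2 => exact Set.union_subset_union h1 h2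
  | imp _ _ h1 h2 => exact Set.union_subset_union h1 h2
  | all x _ h => exact (Set.sdiff_subset.trans h).trans (Set.subset_insert _ _)
  | ex x _ h => exact (Set.sdiff_subset.trans h).trans (Set.subset_insert _ _)

/-- `∃` for `true`, `∀` for `false`. -/
def Qn {L : Lang} {V : Type} (b : Bool) (x : V) (φ : Fml L V) : Fml L V :=
  match b with
  | true => .ex x φ
  | false => .all x φ

/-- `Σ_k` for `true`, `Π_k` for `false`. -/
def Cl {L : Lang} {V : Type} (b : Bool) (k : ℕ) (φ : Fml L V) : Prop :=
  match b with
  | true => φ ∈ SigmaC k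
  | false => φ ∈ PiC k

/-- The cumulative classes. -/
def ClP {L : Lang} {V : Type} (b : Bool) (k : ℕ) (φ : Fml L V) : Prop :=
  Cl b k φ ∨ ∃ i < k, ∃ c, Cl c i φ

theorem Cl_zero {L : Lang} {V : Type} (b : Bool) (φ : Fml L V) : Cl b 0 φ ↔ φ.qf := by
  cases b <;> rfl

theorem Cl_succ {L : Lang} {V : Type} (b : Bool) (k : ℕ) (φ : Fml L V) :
    Cl b (k+1) φ ↔ ∃ x ξ, φ = Qn b x ξ ∧ (Cl b (k+1) ξ ∨ Cl (!b) k ξ) := by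
  cases b
  · constructor
    · intro h
      have h' : AllBlock (SP k).1 φ := h
      cases h' with
      | one h1 => exact ⟨_, _, rfl, Or.inr h1⟩
      | more h1 => exact ⟨_, _, rfl, Or.inl h1⟩
    · rintro ⟨x, ξ, rfl, h | h⟩
      · exact AllBlock.more h
      · exact AllBlock.one h
  · constructor
    · intro h
      have h' : ExBlock (SP k).2 φ := h
      cases h' with
      | one h1 => exact ⟨_, _, rfl, Or.inr h1⟩
      | more h1 => exact ⟨_, _, rfl, Or.inl h1⟩
    · rintro ⟨x, ξ, rfl, h | h⟩
      · exact ExBlock.more h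
      · exact ExBlock.one h

theorem Qn_numQ {L : Lang} {V : Type} (b : Bool) (x : V) (ξ : Fml L V) :
    (Qn b x ξ).numQ = ξ.numQ + 1 := by cases b <;> rfl

theorem Qn_inj {L : Lang} {V : Type} {b c : Bool} {x y : V} {ξ η : Fml L V}
    (h : Qn b x ξ = Qn c y η) : b = c ∧ x = y ∧ ξ = η := by
  cases b <;> cases c <;> simp_all [Qn]

theorem Qn_not_qf {L : Lang} {V : Type} (b : Bool) (x : V) (ξ : Fml L V) :
    ¬ (Qn b x ξ).qf := by cases b <;> exact id

theorem Qn_rename {L : Lang} {V : Type} [DecidableEq V] (b : Bool) (x y z : V) (ξ : Fml L V) :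
    (Qn b z ξ).rename x y = if z = x then Qn b z ξ else Qn b z (ξ.rename x y) := by
  cases b <;> rfl

theorem numQ_rename {L : Lang} {V : Type} [DecidableEq V] (x y : V) (φ : Fml L V) :
    (φ.rename x y).numQ = φ.numQ := by
  induction φ with
  | falsum => rfl
  | rel r ts => rfl
  | and _ _ h1 h2 => simp [Fml.rename, Fml.numQ, h1, h2]
  | or _ _ h1 h2 => simp [Fml.rename, Fml.numQ, h1, h2]
  | imp _ _ h1 h2 => simp [Fml.rename, Fml.numQ, h1, h2]
  | all z _ h => by_cases hz : z = x <;> simp [Fml.rename, Fml.numQ, h, hz]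
  | ex z _ h => by_cases hz : z = x <;> simp [Fml.rename, Fml.numQ, h, hz]

theorem qf_rename {L : Lang} {V : Type} [DecidableEq V] (x y : V) (φ : Fml L V) (h : φ.qf) :
    (φ.rename x y).qf := by
  induction φ with
  | falsum => trivial
  | rel r ts => trivial
  | and _ _ h1 h2 => exact ⟨h1 h.1, h2 h.2⟩
  | or _ _ h1 h2 => exact ⟨h1 h.1, h2 h.2⟩
  | imp _ _ h1 h2 => exact ⟨h1 h.1, h2 h.2⟩
  | all z _ _ => exact h.elim
  | ex z _ _ => exact h.elim

theorem Cl_rename {L : Lang} {V : Type} [DecidableEq V] (x y : V) (n : ℕ) :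
    ∀ (b : Bool) (k : ℕ) (φ : Fml L V), φ.numQ = n → Cl b k φ → Cl b k (φ.rename x y) := by
  induction n with
  | zero =>
    intro b k φ hn h
    cases k with
    | zero => exact (Cl_zero _ _).2 (qf_rename x y φ ((Cl_zero _ _).1 h))
    | succ k =>
      obtain ⟨z, ξ, rfl, _⟩ := (Cl_succ _ _ _).1 h
      simp [Qn_numQ] at hn
  | succ n ih =>
    intro b k φ hn h
    cases k with
    | zero => exact (Cl_zero _ _).2 (qf_rename x y φ ((Cl_zero _ _).1 h))
    | succ k =>
      obtain ⟨z, ξ, rfl, h'⟩ := (Cl_succ _ _ _).1 h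
      rw [Qn_numQ] at hn
      rw [Qn_rename]
      split_ifs
      · exact h
      · exact (Cl_succ _ _ _).2 ⟨z, _, rfl,
          h'.imp (ih _ _ _ (by omega)) (ih _ _ _ (by omega))⟩

theorem ClP_rename {L : Lang} {V : Type} [DecidableEq V] (x y : V) (b : Bool) (k : ℕ)
    (φ : Fml L V) (h : ClP b k φ) : ClP b k (φ.rename x y) := by
  rcases h with h | ⟨i, hi, c, h⟩
  · exact Or.inl (Cl_rename x y _ _ _ _ rfl h)
  · exact Or.inr ⟨i, hi, c, Cl_rename x y _ _ _ _ rfl h⟩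

theorem ClP_sub {L : Lang} {V : Type} {b : Bool} {k : ℕ} {x : V} {ξ : Fml L V}
    (h : ClP b (k+1) (Qn b x ξ)) : ClP b (k+1) ξ := by
  rcases h with h | ⟨i, hi, c, h⟩
  · obtain ⟨z, η, he, h'⟩ := (Cl_succ _ _ _).1 h
    obtain ⟨-, -, rfl⟩ := Qn_inj he
    exact h'.imp id fun h' => ⟨k, by omega, _, h'⟩
  · cases i with
    | zero => exact (Qn_not_qf _ _ _ ((Cl_zero _ _).1 h)).elim
    | succ i =>
      obtain ⟨z, η, he, h'⟩ := (Cl_succ _ _ _).1 h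
      obtain ⟨rfl, -, rfl⟩ := Qn_inj he
      rcases h' with h' | h'
      · exact Or.inr ⟨_, hi, _, h'⟩
      · exact Or.inr ⟨i, by omega, _, h'⟩

theorem ClP_of_not {L : Lang} {V : Type} {b : Bool} {k : ℕ} {ψ : Fml L V}
    (h : ClP b (k+1) ψ) (hn : ∀ x ξ, ψ ≠ Qn b x ξ) : ClP (!b) k ψ := by
  have key : ∀ i c, i ≤ k → Cl c i ψ → ClP (!b) k ψ := by
    intro i c hi h1
    rcases hi.lt_or_eq with hi | rfl
    · exact Or.inr ⟨i, hi, c, h1⟩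
    by_cases hc : c = !b
    · subst hc
      exact Or.inl h1
    obtain rfl : c = b := by cases b <;> cases c <;> simp_all
    cases i with
    | zero => exact Or.inl ((Cl_zero _ _).2 ((Cl_zero _ _).1 h1))
    | succ i =>
      obtain ⟨z, η, he, h'⟩ := (Cl_succ _ _ _).1 h1
      exact (hn _ _ he).elim
  rcases h with h | ⟨i, hi, c, h⟩
  · obtain ⟨z, η, he, h'⟩ := (Cl_succ _ _ _).1 h
    exact (hn _ _ he).elim
  · exact key i c (by omega) h

theorem alt_qf {L : Lang} {V : Type} (φ : Fml L V) (h : φ.qf) : φ.alt = {[]} := by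
  induction φ with
  | falsum => rfl
  | rel r ts => rfl
  | and _ _ h1 h2 => simp [Fml.alt, h1 h.1, h2 h.2]
  | or _ _ h1 h2 => simp [Fml.alt, h1 h.1, h2 h.2]
  | imp _ _ h1 h2 => simp [Fml.alt, h1 h.1, h2 h.2, negPath]
  | all z _ _ => exact h.elim
  | ex z _ _ => exact h.elim

theorem alt_Qn {L : Lang} {V : Type} (b : Bool) (x : V) (ξ : Fml L V) :
    (Qn b x ξ).alt = {s ∈ ξ.alt | s.head? = some b} ∪
      (fun s => b :: s) '' {s ∈ ξ.alt | s.head? ≠ some b} := by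
  cases b <;> rfl

theorem Cl_alt {L : Lang} {V : Type} (n : ℕ) : ∀ (b : Bool) (k : ℕ) (φ : Fml L V),
    φ.numQ = n → Cl b k φ →
    ∃ s : List Bool, φ.alt = {s} ∧ s.length = k ∧ (k ≠ 0 → s.head? = some b) := by
  induction n using Nat.strong_induction_on with
  | _ n ih =>
    intro b k φ hn h
    cases k with
    | zero => exact ⟨[], alt_qf φ ((Cl_zero _ _).1 h), rfl, by simp⟩
    | succ k =>
      obtain ⟨z, ξ, rfl, h'⟩ := (Cl_succ _ _ _).1 h
      rw [Qn_numQ] at hn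
      rw [alt_Qn]
      rcases h' with h' | h'
      · obtain ⟨s, hs, hl, hh⟩ := ih ξ.numQ (by omega) _ _ ξ rfl h'
        have hh := hh (by omega)
        refine ⟨s, ?_, hl, fun _ => hh⟩
        ext t
        simp only [hs, Set.mem_union, Set.mem_ofPred_eq, Set.mem_singleton_iff, Set.mem_image]
        constructor
        · rintro (⟨rfl, -⟩ | ⟨u, ⟨rfl, hu⟩, -⟩)
          · rfl
          · exact (hu hh).elim
        · rintro rfl
          exact Or.inl ⟨rfl, hh⟩
      · obtain ⟨s, hs, hl, hh⟩ := ih ξ.numQ (by omega) _ _ ξ rfl h'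
        have hne : s.head? ≠ some b := by
          by_cases hk : k = 0
          · subst hk
            simp [List.length_eq_zero_iff.1 hl]
          · rw [hh hk]
            cases b <;> simp
        refine ⟨b :: s, ?_, by simp [hl], fun _ => rfl⟩
        ext t
        simp only [hs, Set.mem_union, Set.mem_ofPred_eq, Set.mem_singleton_iff, Set.mem_image]
        constructor
        · rintro (⟨rfl, hu⟩ | ⟨u, ⟨rfl, hu⟩, rfl⟩)
          · exact (hne hu).elim
          · rfl
        · rintro rfl
          exact Or.inr ⟨s, ⟨rfl, hne⟩, rfl⟩

theorem Cl_deg {L : Lang} {V : Type} {b : Bool} {k : ℕ} {φ : Fml L V} (h : Cl b k φ) :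
    φ.deg = k := by
  obtain ⟨s, hs, hl, -⟩ := Cl_alt _ b k φ rfl h
  simp [Fml.deg, hs, hl]

/-- The properties of `∧` and `∨` used in the proof. -/
structure Good {L : Lang} {V : Type} [DecidableEq V]
    (op : Fml L V → Fml L V → Fml L V) : Prop where
  qf : ∀ a b, a.qf → b.qf → (op a b).qf
  pL : ∀ b x ξ δ, x ∉ δ.fv → Step (op (Qn b x ξ) δ) (Qn b x (op ξ δ))
  pR : ∀ b x ξ δ, x ∉ δ.fv → Step (op δ (Qn b x ξ)) (Qn b x (op δ ξ))
  cL : ∀ a a' c, Repl Step a a' → Repl Step (op a c) (op a' c)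
  cR : ∀ a a' c, Repl Step a a' → Repl Step (op c a) (op c a')

theorem Good.flip {L : Lang} {V : Type} [DecidableEq V]
    {op : Fml L V → Fml L V → Fml L V} (h : Good op) : Good (fun a b => op b a) :=
  ⟨fun a b ha hb => h.qf b a hb ha, h.pR, h.pL, h.cR, h.cL⟩

theorem good_and {L : Lang} {V : Type} [DecidableEq V] :
    Good (Fml.and : Fml L V → Fml L V → Fml L V) where
  qf := fun _ _ ha hb => ⟨ha, hb⟩
  pL := fun b x ξ δ h => by
    cases b
    · exact Step.r4all x ξ δ h
    · exact Step.r4ex x ξ δ h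
  pR := fun b x ξ δ h => by
    cases b
    · exact Step.r5all x ξ δ h
    · exact Step.r5ex x ξ δ h
  cL := fun _ _ _ h => Repl.andL h
  cR := fun _ _ _ h => Repl.andR h

theorem good_or {L : Lang} {V : Type} [DecidableEq V] :
    Good (Fml.or : Fml L V → Fml L V → Fml L V) where
  qf := fun _ _ ha hb => ⟨ha, hb⟩
  pL := fun b x ξ δ h => by
    cases b
    · exact Step.r6all x ξ δ h
    · exact Step.r6ex x ξ δ h
  pR := fun b x ξ δ h => by
    cases b
    · exact Step.r7all x ξ δ h
    · exact Step.r7ex x ξ δ h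
  cL := fun _ _ _ h => Repl.orL h
  cR := fun _ _ _ h => Repl.orR h

theorem DTA_Qn {L : Lang} {V : Type} [DecidableEq V] (b : Bool) (x : V) {φ ψ : Fml L V}
    (h : DTA φ ψ) : DTA (Qn b x φ) (Qn b x ψ) := by
  unfold DTA at h
  induction h with
  | refl => exact Relation.ReflTransGen.refl
  | tail _ hac ih =>
    refine Relation.ReflTransGen.tail ih ?_
    cases b
    · exact Repl.allC hac
    · exact Repl.exC hac

theorem step_rename {L : Lang} {V : Type} [DecidableEq V] (b : Bool) (x y : V) (ξ : Fml L V)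
    (h : y ∉ ξ.vars) : Step (Qn b x ξ) (Qn b y (ξ.rename x y)) := by
  cases b
  · exact Step.r8all x y ξ h
  · exact Step.r8ex x y ξ h

/-- Rename the bound variable, then pull the quantifier out of the left argument. -/
theorem pull {L : Lang} {V : Type} [DecidableEq V] [Infinite V]
    {op : Fml L V → Fml L V → Fml L V} (h : Good op) (b : Bool) (x : V) (ξ δ : Fml L V) :
    ∃ y, DTA (op (Qn b x ξ) δ) (Qn b y (op (ξ.rename x y) δ)) := by
  obtain ⟨y, hy⟩ := (ξ.vars_finite.union δ.vars_finite).exists_notMem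
  rw [Set.mem_union, not_or] at hy
  refine ⟨y, Relation.ReflTransGen.head (h.cL _ _ _ (Repl.base (step_rename b x y ξ hy.1))) ?_⟩
  exact Relation.ReflTransGen.single
    (Repl.base (h.pL b y _ _ fun hf => hy.2 (δ.fv_subset_vars hf)))

theorem main_aux {L : Lang} {V : Type} [DecidableEq V] [Infinite V]
    {op : Fml L V → Fml L V → Fml L V} (h : Good op) (n : ℕ) :
    ∀ (b : Bool) (k : ℕ) (φ ψ : Fml L V), φ.numQ + ψ.numQ = n → Cl b k φ → ClP b k ψ →
      ∃ σ, Cl b k σ ∧ DTA (op φ ψ) σ := by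
  induction n with
  | zero =>
    intro b k φ ψ hn hφ hψ
    cases k with
    | zero =>
      rcases hψ with hψ | ⟨i, hi, -⟩
      · exact ⟨_, (Cl_zero _ _).2 (h.qf _ _ ((Cl_zero _ _).1 hφ) ((Cl_zero _ _).1 hψ)),
          Relation.ReflTransGen.refl⟩
      · omega
    | succ k =>
      obtain ⟨z, ξ, rfl, _⟩ := (Cl_succ _ _ _).1 hφ
      rw [Qn_numQ] at hn
      omega
  | succ n ih =>
    intro b k φ ψ hn hφ hψ
    cases k with
    | zero =>
      rcases hψ with hψ | ⟨i, hi, -⟩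
      · exact ⟨_, (Cl_zero _ _).2 (h.qf _ _ ((Cl_zero _ _).1 hφ) ((Cl_zero _ _).1 hψ)),
          Relation.ReflTransGen.refl⟩
      · omega
    | succ k =>
      by_cases hq : ∃ x ξ, ψ = Qn b x ξ
      · obtain ⟨x, ξ, rfl⟩ := hq
        rw [Qn_numQ] at hn
        obtain ⟨y, hy⟩ := pull h.flip b x ξ φ
        obtain ⟨σ, hσ, hd⟩ := ih b (k+1) φ (ξ.rename x y) (by rw [numQ_rename]; omega) hφ
          (ClP_rename x y _ _ _ (ClP_sub hψ))
        exact ⟨Qn b y σ, (Cl_succ _ _ _).2 ⟨y, σ, rfl, Or.inl hσ⟩,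
          Relation.ReflTransGen.trans hy (DTA_Qn b y hd)⟩
      · obtain ⟨x, ξ, rfl, hξ⟩ := (Cl_succ _ _ _).1 hφ
        rw [Qn_numQ] at hn
        obtain ⟨y, hy⟩ := pull h b x ξ ψ
        rcases hξ with hξ | hξ
        · obtain ⟨σ, hσ, hd⟩ := ih b (k+1) (ξ.rename x y) ψ (by rw [numQ_rename]; omega)
            (Cl_rename x y _ _ _ _ rfl hξ) hψ
          exact ⟨Qn b y σ, (Cl_succ _ _ _).2 ⟨y, σ, rfl, Or.inl hσ⟩,
            Relation.ReflTransGen.trans hy (DTA_Qn b y hd)⟩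
        · obtain ⟨σ, hσ, hd⟩ := ih (!b) k (ξ.rename x y) ψ (by rw [numQ_rename]; omega)
            (Cl_rename x y _ _ _ _ rfl hξ)
            (ClP_of_not hψ fun x ξ he => hq ⟨x, ξ, he⟩)
          exact ⟨Qn b y σ, (Cl_succ _ _ _).2 ⟨y, σ, rfl, Or.inr hσ⟩,
            Relation.ReflTransGen.trans hy (DTA_Qn b y hd)⟩

theorem main_thm {L : Lang} {V : Type} [DecidableEq V] [Infinite V]
    {op : Fml L V → Fml L V → Fml L V} (h : Good op) (b : Bool) (k : ℕ) (φ ψ : Fml L V)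
    (hφ : ClP b k φ) (hψ : ClP b k ψ) (hk : k = max φ.deg ψ.deg) :
    ∃ σ, Cl b k σ ∧ DTA (op φ ψ) σ := by
  rcases hφ with hφ | hφ
  · exact main_aux h _ b k φ ψ rfl hφ hψ
  rcases hψ with hψ | hψ
  · exact main_aux h.flip _ b k ψ φ rfl hψ (Or.inr hφ)
  obtain ⟨i, hi, c, hc⟩ := hφ
  obtain ⟨j, hj, d, hd⟩ := hψ
  rw [Cl_deg hc, Cl_deg hd] at hk
  omega

theorem ClP_true {L : Lang} {V : Type} {k : ℕ} {φ : Fml L V} (h : φ ∈ SigmaP k) :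
    ClP true k φ := by
  rcases h with h | h
  · exact Or.inl h
  · simp only [Set.mem_iUnion] at h
    obtain ⟨i, hi, h | h⟩ := h
    · exact Or.inr ⟨i, hi, true, h⟩
    · exact Or.inr ⟨i, hi, false, h⟩

theorem ClP_false {L : Lang} {V : Type} {k : ℕ} {φ : Fml L V} (h : φ ∈ PiP k) :
    ClP false k φ := by
  rcases h with h | h
  · exact Or.inl h
  · simp only [Set.mem_iUnion] at h
    obtain ⟨i, hi, h | h⟩ := h
    · exact Or.inr ⟨i, hi, true, h⟩
    · exact Or.inr ⟨i, hi, false, h⟩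

/-- for ∘ ∈ {∧, ∨}:
(A) if φ, ψ ∈ Σ_{k+1}^+ and k+1 = max{deg φ, deg ψ}, then φ ∘ ψ ⊳* some σ ∈ Σ_{k+1};
(B) if φ, ψ ∈ Π_{k+1}^+ and k+1 = max{deg φ, deg ψ}, then φ ∘ ψ ⊳* some π ∈ Π_{k+1}. -/
theorem stmt12 {L : Lang} {V : Type} [DecidableEq V] [Infinite V] (k : ℕ)
    (op : Fml L V → Fml L V → Fml L V) (hop : op = Fml.and ∨ op = Fml.or) :
    (∀ φ ψ : Fml L V, φ ∈ SigmaP (k+1) → ψ ∈ SigmaP (k+1) →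
      k + 1 = max φ.deg ψ.deg → ∃ σ ∈ SigmaC (k+1), DTA (op φ ψ) σ) ∧
    (∀ φ ψ : Fml L V, φ ∈ PiP (k+1) → ψ ∈ PiP (k+1) →
      k + 1 = max φ.deg ψ.deg → ∃ π ∈ PiC (k+1), DTA (op φ ψ) π) := by
  have hg : Good op := by
    rcases hop with rfl | rfl
    · exact good_and
    · exact good_or
  exact ⟨fun φ ψ hφ hψ hk => main_thm hg true (k+1) φ ψ (ClP_true hφ) (ClP_true hψ) hk,
    fun φ ψ hφ hψ hk => main_thm hg false (k+1) φ ψ (ClP_false hφ) (ClP_false hψ) hk⟩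

end PrenexPaper
end

section
/- Suppose ψ is obtained by replacing one occurrence of a subformula ξ of φ with a formula δ such that ξ ⊳ δ. Then for every natural number k: (1) if ψ ∈ E_k^+, then φ ∈ E_k^+; (2) if ψ ∈ U_k^+, then φ ∈ U_k^+. -/
namespace PrenexPaper

variable {L : Lang} {V : Type}

/-! ### Prenex transformations -/

variable [DecidableEq V]

/-- Prefixing a path by a quantifier symbol. -/
def pre (b : Bool) (s : List Bool) : List Bool := if s.head? = some b then s else b :: s

theorem pre_image (b : Bool) (A : Set (List Bool)) :
    {s ∈ A | s.head? = some b} ∪ (fun s => b :: s) '' {s ∈ A | s.head? ≠ some b} = pre b '' A := by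
  ext t
  simp only [Set.mem_union, Set.mem_image, Set.mem_setOf_eq, pre]
  constructor
  · rintro (⟨h1, h2⟩ | ⟨s, ⟨h1, h2⟩, rfl⟩)
    · exact ⟨t, h1, by simp [h2]⟩
    · exact ⟨s, h1, by simp [h2]⟩
  · rintro ⟨s, h1, h2⟩
    by_cases h : s.head? = some b
    · rw [if_pos h] at h2; subst h2; exact Or.inl ⟨h1, h⟩
    · rw [if_neg h] at h2; exact Or.inr ⟨s, ⟨h1, h⟩, h2⟩

theorem alt_all (x : V) (φ : Fml L V) : (Fml.all x φ).alt = pre false '' φ.alt := by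
  rw [← pre_image]; rfl

theorem alt_ex (x : V) (φ : Fml L V) : (Fml.ex x φ).alt = pre true '' φ.alt := by
  rw [← pre_image]; rfl

/-- Recursive description of alternating lists. -/
def AltL : List Bool → Prop
  | [] => True
  | b :: s => s.head? ≠ some b ∧ AltL s

theorem altL_pre (b : Bool) (s : List Bool) (h : AltL s) : AltL (pre b s) := by
  unfold pre
  split_ifs with h1
  · exact h
  · exact ⟨h1, h⟩

theorem altL_neg (s : List Bool) (h : AltL s) : AltL (negPath s) := by
  induction s with
  | nil => exact h
  | cons b s ih =>
    refine ⟨?_, ih h.2⟩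
    have := h.1
    cases s with
    | nil => simp
    | cons c s => cases b <;> cases c <;> simp_all

theorem altL_alt (φ : Fml L V) : ∀ s ∈ φ.alt, AltL s := by
  induction φ with
  | falsum => rintro s rfl; trivial
  | rel => rintro s rfl; trivial
  | and _ _ ih1 ih2 => rintro s (h | h); exacts [ih1 s h, ih2 s h]
  | or _ _ ih1 ih2 => rintro s (h | h); exacts [ih1 s h, ih2 s h]
  | imp _ _ ih1 ih2 =>
    rintro s (⟨t, h, rfl⟩ | h)
    exacts [altL_neg _ (ih1 t h), ih2 s h]
  | all _ _ ih => rw [alt_all]; rintro _ ⟨t, h, rfl⟩; exact altL_pre _ _ (ih t h)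
  | ex _ _ ih => rw [alt_ex]; rintro _ ⟨t, h, rfl⟩; exact altL_pre _ _ (ih t h)

theorem alt_fin (φ : Fml L V) : φ.alt.Finite ∧ φ.alt.Nonempty := by
  induction φ with
  | falsum => exact ⟨Set.finite_singleton _, Set.singleton_nonempty _⟩
  | rel => exact ⟨Set.finite_singleton _, Set.singleton_nonempty _⟩
  | and _ _ ih1 ih2 => exact ⟨ih1.1.union ih2.1, ih1.2.inl⟩
  | or _ _ ih1 ih2 => exact ⟨ih1.1.union ih2.1, ih1.2.inl⟩
  | imp _ _ ih1 ih2 => exact ⟨(ih1.1.image _).union ih2.1, ih2.2.inr⟩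
  | all _ _ ih => rw [alt_all]; exact ⟨ih.1.image _, ih.2.image _⟩
  | ex _ _ ih => rw [alt_ex]; exact ⟨ih.1.image _, ih.2.image _⟩

theorem le_deg (φ : Fml L V) (s : List Bool) (h : s ∈ φ.alt) : s.length ≤ φ.deg :=
  le_csSup ((alt_fin φ).1.image _).bddAbove ⟨s, h, rfl⟩

theorem deg_le (φ : Fml L V) (k : ℕ) (h : ∀ s ∈ φ.alt, s.length ≤ k) : φ.deg ≤ k :=
  csSup_le ((alt_fin φ).2.image _) (by rintro _ ⟨s, hs, rfl⟩; exact h s hs)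

/-- Path-wise bound. -/
def Bd (b : Bool) (k : ℕ) (φ : Fml L V) : Prop :=
  ∀ s ∈ φ.alt, s.length ≤ k ∧ (s.length = k → k ≠ 0 → s.head? = some b)

theorem mem_EcP (k : ℕ) (φ : Fml L V) : φ ∈ EcP k ↔ Bd true k φ := by
  simp only [EcP, Set.mem_union, Set.mem_iUnion, Fc, Set.mem_setOf_eq, exists_prop,
    exists_eq_right']
  constructor
  · rintro (h | h) s hs
    · have := le_deg φ s hs
      cases k with
      | zero => have h' : φ.deg = 0 := h; exact ⟨by omega, by simp⟩
      | succ k => have h' : φ.deg = k + 1 := h.1; exact ⟨by omega, fun e _ => h.2 s hs e⟩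
    · have := le_deg φ s hs
      exact ⟨by omega, by omega⟩
  · intro h
    rcases (deg_le φ k fun s hs => (h s hs).1).lt_or_eq with h1 | h1
    · exact Or.inr h1
    · left
      cases k with
      | zero => exact h1
      | succ k => exact ⟨h1, fun s hs e => (h s hs).2 e (by omega)⟩

theorem mem_UcP (k : ℕ) (φ : Fml L V) : φ ∈ UcP k ↔ Bd false k φ := by
  simp only [UcP, Set.mem_union, Set.mem_iUnion, Fc, Set.mem_setOf_eq, exists_prop,
    exists_eq_right']
  constructor
  · rintro (h | h) s hs
    · have := le_deg φ s hs
      cases k with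
      | zero => have h' : φ.deg = 0 := h; exact ⟨by omega, by simp⟩
      | succ k => have h' : φ.deg = k + 1 := h.1; exact ⟨by omega, fun e _ => h.2 s hs e⟩
    · have := le_deg φ s hs
      exact ⟨by omega, by omega⟩
  · intro h
    rcases (deg_le φ k fun s hs => (h s hs).1).lt_or_eq with h1 | h1
    · exact Or.inr h1
    · left
      cases k with
      | zero => exact h1
      | succ k => exact ⟨h1, fun s hs e => (h s hs).2 e (by omega)⟩

/-- Domination of paths and of path sets. -/
def Dm (s t : List Bool) : Prop := s = t ∨ s.length < t.length

/-- Domination of path sets. -/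
def DS (A B : Set (List Bool)) : Prop := ∀ s ∈ A, ∃ t ∈ B, Dm s t

theorem DS.rfl' (A : Set (List Bool)) : DS A A := fun s h => ⟨s, h, Or.inl rfl⟩

theorem DS.union {A B C D : Set (List Bool)} (h1 : DS A C) (h2 : DS B D) :
    DS (A ∪ B) (C ∪ D) := by
  rintro s (h | h)
  · obtain ⟨t, ht, h⟩ := h1 s h; exact ⟨t, Or.inl ht, h⟩
  · obtain ⟨t, ht, h⟩ := h2 s h; exact ⟨t, Or.inr ht, h⟩

theorem DS.neg {A B : Set (List Bool)} (h1 : DS A B) : DS (negPath '' A) (negPath '' B) := by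
  rintro _ ⟨s, h, rfl⟩
  obtain ⟨t, ht, h⟩ := h1 s h
  refine ⟨_, ⟨t, ht, rfl⟩, ?_⟩
  rcases h with rfl | h
  · exact Or.inl rfl
  · right; simpa [negPath] using h

theorem altL_eq (s t : List Bool) (hs : AltL s) (ht : AltL t) (hl : s.length = t.length)
    (hh : s.head? = t.head?) : s = t := by
  induction s generalizing t with
  | nil => cases t <;> simp_all
  | cons b s ih =>
    cases t with
    | nil => simp at hl
    | cons c t =>
      obtain rfl : b = c := by simpa using hh
      congr 1
      refine ih t hs.2 ht.2 (by simpa using hl) ?_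
      have h1 := hs.1
      have h2 := ht.1
      cases s <;> cases t <;> simp at hl h1 h2 ⊢
      revert h1 h2
      rename_i c _ d _
      cases b <;> cases c <;> cases d <;> simp

theorem pre_head (b : Bool) (s : List Bool) : (pre b s).head? = some b := by
  unfold pre; split_ifs with h
  · exact h
  · rfl

theorem pre_len (b : Bool) (s : List Bool) :
    s.length ≤ (pre b s).length ∧ (pre b s).length ≤ s.length + 1 := by
  unfold pre; split_ifs <;> simp

theorem dm_pre_self (b : Bool) (s : List Bool) : Dm s (pre b s) := by
  unfold pre Dm; split_ifs <;> simp

theorem DS.pre {A B : Set (List Bool)} (b : Bool) (hA : ∀ s ∈ A, AltL s) (hB : ∀ s ∈ B, AltL s)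
    (h1 : DS A B) : DS (pre b '' A) (pre b '' B) := by
  rintro _ ⟨s, hs, rfl⟩
  obtain ⟨t, ht, h⟩ := h1 s hs
  refine ⟨_, ⟨t, ht, rfl⟩, ?_⟩
  rcases h with rfl | h
  · exact Or.inl rfl
  · have e1 := pre_len b s
    have e2 := pre_len b t
    by_cases hl : (PrenexPaper.pre b s).length = (PrenexPaper.pre b t).length
    · left
      exact altL_eq _ _ (altL_pre _ _ (hA s hs)) (altL_pre _ _ (hB t ht)) hl
        (by rw [pre_head, pre_head])
    · right; omega

theorem DS.self_pre (A : Set (List Bool)) (b : Bool) : DS A (PrenexPaper.pre b '' A) :=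
  fun s hs => ⟨_, ⟨s, hs, rfl⟩, dm_pre_self b s⟩

theorem neg_pre (b : Bool) (s : List Bool) : negPath (pre b s) = pre (!b) (negPath s) := by
  cases s with
  | nil => simp [pre, negPath]
  | cons c s => cases b <;> cases c <;> simp [pre, negPath]

theorem neg_pre_image (b : Bool) (A : Set (List Bool)) :
    negPath '' (pre b '' A) = pre (!b) '' (negPath '' A) := by
  simp only [Set.image_image, neg_pre]

theorem alt_rename [DecidableEq V] (x y : V) (φ : Fml L V) : (φ.rename x y).alt = φ.alt := by
  induction φ with
  | falsum => rfl
  | rel => rfl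
  | and _ _ ih1 ih2 => simp only [Fml.rename, Fml.alt, ih1, ih2]
  | or _ _ ih1 ih2 => simp only [Fml.rename, Fml.alt, ih1, ih2]
  | imp _ _ ih1 ih2 => simp only [Fml.rename, Fml.alt, ih1, ih2]
  | all z _ ih => 
    simp only [Fml.rename]; split_ifs
    · rfl
    · rw [alt_all, alt_all, ih]
  | ex z _ ih => 
    simp only [Fml.rename]; split_ifs
    · rfl
    · rw [alt_ex, alt_ex, ih]

theorem DS.left (b : Bool) (A B : Set (List Bool)) :
    DS (PrenexPaper.pre b '' A ∪ B) (PrenexPaper.pre b '' (A ∪ B)) := by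
  rw [Set.image_union]; exact (DS.rfl' _).union (DS.self_pre _ _)

theorem DS.right (b : Bool) (A B : Set (List Bool)) :
    DS (B ∪ PrenexPaper.pre b '' A) (PrenexPaper.pre b '' (B ∪ A)) := by
  rw [Set.image_union]; exact (DS.self_pre _ _).union (DS.rfl' _)

theorem step_ds [DecidableEq V] {φ ψ : Fml L V} (h : Step φ ψ) : DS φ.alt ψ.alt := by
  cases h with
  | r1 x ξ δ h =>
    rw [alt_all]
    change DS (negPath '' (Fml.ex x ξ).alt ∪ δ.alt) _
    rw [alt_ex, neg_pre_image]; exact DS.left _ _ _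
  | r2 x ξ δ h =>
    rw [alt_ex]
    change DS (negPath '' (Fml.all x ξ).alt ∪ δ.alt) _
    rw [alt_all, neg_pre_image]; exact DS.left _ _ _
  | r3all x ξ δ h =>
    rw [alt_all]; change DS (_ ∪ (Fml.all x ξ).alt) _; rw [alt_all]; exact DS.right _ _ _
  | r3ex x ξ δ h =>
    rw [alt_ex]; change DS (_ ∪ (Fml.ex x ξ).alt) _; rw [alt_ex]; exact DS.right _ _ _
  | r4all x ξ δ h =>
    rw [alt_all]; change DS ((Fml.all x ξ).alt ∪ _) _; rw [alt_all]; exact DS.left _ _ _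
  | r4ex x ξ δ h =>
    rw [alt_ex]; change DS ((Fml.ex x ξ).alt ∪ _) _; rw [alt_ex]; exact DS.left _ _ _
  | r5all x ξ δ h =>
    rw [alt_all]; change DS (_ ∪ (Fml.all x ξ).alt) _; rw [alt_all]; exact DS.right _ _ _
  | r5ex x ξ δ h =>
    rw [alt_ex]; change DS (_ ∪ (Fml.ex x ξ).alt) _; rw [alt_ex]; exact DS.right _ _ _
  | r6all x ξ δ h =>
    rw [alt_all]; change DS ((Fml.all x ξ).alt ∪ _) _; rw [alt_all]; exact DS.left _ _ _
  | r6ex x ξ δ h =>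
    rw [alt_ex]; change DS ((Fml.ex x ξ).alt ∪ _) _; rw [alt_ex]; exact DS.left _ _ _
  | r7all x ξ δ h =>
    rw [alt_all]; change DS (_ ∪ (Fml.all x ξ).alt) _; rw [alt_all]; exact DS.right _ _ _
  | r7ex x ξ δ h =>
    rw [alt_ex]; change DS (_ ∪ (Fml.ex x ξ).alt) _; rw [alt_ex]; exact DS.right _ _ _
  | r8all x y ξ h => rw [alt_all, alt_all, alt_rename]; exact DS.rfl' _
  | r8ex x y ξ h => rw [alt_ex, alt_ex, alt_rename]; exact DS.rfl' _

theorem repl_ds [DecidableEq V] {φ ψ : Fml L V} (h : Repl Step φ ψ) : DS φ.alt ψ.alt := by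
  induction h with
  | base h => exact step_ds h
  | andL _ ih => exact ih.union (DS.rfl' _)
  | andR _ ih => exact (DS.rfl' _).union ih
  | orL _ ih => exact ih.union (DS.rfl' _)
  | orR _ ih => exact (DS.rfl' _).union ih
  | impL _ ih => exact ih.neg.union (DS.rfl' _)
  | impR _ ih => exact (DS.rfl' _).union ih
  | allC _ ih => rw [alt_all, alt_all]; exact ih.pre _ (altL_alt _) (altL_alt _)
  | exC _ ih => rw [alt_ex, alt_ex]; exact ih.pre _ (altL_alt _) (altL_alt _)

theorem bd_of_ds {φ ψ : Fml L V} (h : DS φ.alt ψ.alt) (b : Bool) (k : ℕ) (hb : Bd b k ψ) :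
    Bd b k φ := by
  intro s hs
  obtain ⟨t, ht, h⟩ := h s hs
  have := hb t ht
  rcases h with rfl | h
  · exact this
  · exact ⟨by omega, by omega⟩

/-- if ψ is obtained by replacing one occurrence of a subformula ξ of φ
with δ such that ξ ⊳ δ, then: (1) ψ ∈ E_k^+ → φ ∈ E_k^+; (2) ψ ∈ U_k^+ → φ ∈ U_k^+. -/
theorem stmt17 {L : Lang} {V : Type} [DecidableEq V] {φ ψ : Fml L V}
    (h : Repl Step φ ψ) (k : ℕ) :
    (ψ ∈ EcP k → φ ∈ EcP k) ∧ (ψ ∈ UcP k → φ ∈ UcP k) := by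
  rw [mem_EcP, mem_EcP, mem_UcP, mem_UcP]
  exact ⟨bd_of_ds (repl_ds h) _ k, bd_of_ds (repl_ds h) _ k⟩

end PrenexPaper
end
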